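/- arXiv:2108.03520 — 6 statements merged into one kernel-verified Lean document; each statement's English description precedes it below -/
import Mathlib

section
/- Let c > 0 be a real number with c ≠ 1. For real u > 1, the series F(u) := Σ_{ℓ=0}^{∞} u^{−(c+ℓ−1)} / ((c+ℓ)(c+ℓ−1)) converges, and F is twice differentiable on (1, ∞) with F''(u) = u^{−c}/(u−1) for all u > 1. -/
open Real

lemma aux_hasSum (a u : ℝ) (hu : 1 < u) :
    HasSum (fun l : ℕ => u ^ (-(a + l))) (u ^ (-a) * (1 - u⁻¹)⁻¹) := by
  have h0 : (0:ℝ) < u := by linarith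
  have h := (hasSum_geometric_of_lt_one (inv_nonneg.2 h0.le) (inv_lt_one_of_one_lt₀ hu)).mul_left
    (u ^ (-a))
  refine h.congr_fun ?_
  intro l
  rw [neg_add, rpow_add h0, rpow_neg h0.le (l : ℝ), rpow_natCast, inv_pow]

lemma aux_summable (a u K : ℝ) (b : ℕ → ℝ) (hb : ∀ l, |b l| ≤ K) (hu : 1 < u) :
    Summable (fun l : ℕ => u ^ (-(a + l)) * b l) := by
  refine Summable.of_norm_bounded ((aux_hasSum a u hu).summable.mul_right K) ?_
  intro l
  have h0 : (0:ℝ) < u := by linarith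
  rw [norm_mul, norm_eq_abs, norm_eq_abs, abs_of_nonneg (rpow_nonneg h0.le _)]
  exact mul_le_mul_of_nonneg_left (hb l) (rpow_nonneg h0.le _)

lemma aux_deriv (a u K M : ℝ) (b d : ℕ → ℝ) (ha : 0 ≤ a + 1) (hb : ∀ l, |b l| ≤ K)
    (hd : ∀ l, |d l| ≤ M) (hbd : ∀ l : ℕ, -(a + l) * b l = d l) (hu : 1 < u) :
    HasDerivAt (fun v : ℝ => ∑' l : ℕ, v ^ (-(a + l)) * b l)
      (∑' l : ℕ, u ^ (-((a + 1) + l)) * d l) u := by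
  obtain ⟨r, hr1, hru⟩ := exists_between hu
  refine hasDerivAt_tsum_of_isPreconnected (t := Set.Ioi r) (y₀ := u)
    (g := fun (l : ℕ) (v : ℝ) => v ^ (-(a + l)) * b l)
    (g' := fun (l : ℕ) (v : ℝ) => v ^ (-((a + 1) + l)) * d l)
    ((aux_hasSum (a + 1) r hr1).summable.mul_right M) isOpen_Ioi isPreconnected_Ioi
    ?_ ?_ hru (aux_summable a u K b hb hu) hru
  · intro l y hy
    have hy' : r < y := hy
    have h0 : y ≠ 0 := by linarith
    have h := (hasDerivAt_rpow_const (p := -(a + l)) (Or.inl h0)).mul_const (b l)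
    refine h.congr_deriv ?_
    rw [← hbd, show -(a + (l:ℝ)) - 1 = -((a + 1) + l) by ring]
    ring
  · intro l y hy
    have hy' : r < y := hy
    have h0 : 0 < y := by linarith
    have hr0 : 0 < r := by linarith
    rw [norm_mul, norm_eq_abs, norm_eq_abs, abs_of_nonneg (rpow_nonneg h0.le _)]
    refine mul_le_mul ?_ (hd l) (abs_nonneg _) (rpow_nonneg hr0.le _)
    refine rpow_le_rpow_of_nonpos hr0 hy'.le ?_
    have : (0:ℝ) ≤ l := l.cast_nonneg
    linarith

/-- for `c > 0`, `c ≠ 1`, the series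
`F(u) = ∑_{ℓ=0}^∞ u^{−(c+ℓ−1)}/((c+ℓ)(c+ℓ−1))` converges for every `u > 1`,
and `F` is twice differentiable on `(1, ∞)` with `F''(u) = u^{−c}/(u−1)`. -/
theorem stmt_5 (c : ℝ) (hc : 0 < c) (hc1 : c ≠ 1) :
    (∀ u : ℝ, 1 < u →
      Summable (fun ℓ : ℕ => u ^ (-(c + ℓ - 1)) / ((c + ℓ) * (c + ℓ - 1)))) ∧
    ∃ F' : ℝ → ℝ,
      (∀ u : ℝ, 1 < u →
        HasDerivAt
          (fun v : ℝ => ∑' ℓ : ℕ, v ^ (-(c + ℓ - 1)) / ((c + ℓ) * (c + ℓ - 1)))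
          (F' u) u) ∧
      (∀ u : ℝ, 1 < u → HasDerivAt F' (u ^ (-c) / (u - 1)) u) := by
  have hpos : ∀ l : ℕ, 0 < c + (l:ℝ) := fun l => by positivity
  have hne : ∀ l : ℕ, c + (l:ℝ) - 1 ≠ 0 := by
    intro l
    rcases l with _ | l
    · simpa [sub_eq_zero] using hc1
    · push_cast
      have := hpos l
      intro h
      linarith
  have hB1 : ∀ l : ℕ, |-(c + (l:ℝ))⁻¹| ≤ c⁻¹ := by
    intro l
    rw [abs_neg, abs_of_pos (inv_pos.2 (hpos l))]
    exact inv_anti₀ hc (by simp)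
  have hB2 : ∀ l : ℕ, |(c + (l:ℝ) - 1)⁻¹| ≤ |c - 1|⁻¹ + c⁻¹ := by
    intro l
    have h1 : 0 ≤ |c - 1|⁻¹ := by positivity
    have h2 : 0 < c⁻¹ := by positivity
    rcases l with _ | l
    · simp [abs_inv, h2.le]
    · have h3 := hB1 l
      rw [abs_neg] at h3
      have h4 : c + ((l + 1 : ℕ) : ℝ) - 1 = c + l := by push_cast; ring
      rw [h4]
      linarith
  have hB0 : ∀ l : ℕ, |((c + (l:ℝ)) * (c + l - 1))⁻¹| ≤ c⁻¹ * (|c - 1|⁻¹ + c⁻¹) := by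
    intro l
    have h3 := hB1 l
    rw [abs_neg] at h3
    rw [mul_inv, abs_mul]
    exact mul_le_mul h3 (hB2 l) (abs_nonneg _) (by positivity)
  have hexp : ∀ l : ℕ, c + (l:ℝ) - 1 = (c - 1) + l := fun l => by ring
  have key : ∀ (v : ℝ) (l : ℕ), v ^ (-(c + (l:ℝ) - 1)) / ((c + l) * (c + l - 1))
      = v ^ (-((c - 1) + (l:ℝ))) * ((c + (l:ℝ)) * (c + l - 1))⁻¹ := by
    intro v l
    rw [div_eq_mul_inv, ← hexp]
  simp only [key]
  refine ⟨fun u hu => aux_summable _ u _ _ hB0 hu,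
    fun u => ∑' l : ℕ, u ^ (-(c + (l:ℝ))) * (-(c + (l:ℝ))⁻¹), fun u hu => ?_, fun u hu => ?_⟩
  · have h := aux_deriv (c - 1) u _ _ (fun l : ℕ => ((c + (l:ℝ)) * (c + l - 1))⁻¹)
      (fun l : ℕ => -(c + (l:ℝ))⁻¹) (by linarith) hB0 hB1 (by
        intro l
        have h1 := hne l
        have h2 := (hpos l).ne'
        rw [← hexp]
        field_simp) hu
    simpa only [sub_add_cancel] using h
  · have h := aux_deriv c u _ 1 (fun l : ℕ => -(c + (l:ℝ))⁻¹)
      (fun _ => 1) (by linarith) hB1 (by simp) (by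
        intro l
        have h2 := (hpos l).ne'
        field_simp) hu
    refine h.congr_deriv ?_
    simp only [mul_one]
    rw [(aux_hasSum (c + 1) u hu).tsum_eq]
    have h0 : 0 < u := by linarith
    have h1 : u - 1 ≠ 0 := by linarith
    rw [neg_add, rpow_add h0, rpow_neg_one]
    field_simp
end

section
/- Let s = σ + it be a complex number with σ ≥ 1/2. Then Re(Γ_ℝ'(s)/Γ_ℝ(s)) ≤ −(log π + γ)/2 + (1/4)·log(σ² + t²), where Γ_ℝ(s) := π^{−s/2} Γ(s/2), Γ_ℝ' denotes its complex derivative, and γ is the Euler–Mascheroni constant. (Note log π + γ > 1.721.) -/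
open Real

noncomputable def Uaux (x y : ℝ) : ℝ :=
  Real.log (x ^ 2 + y ^ 2) / 2 - (x / 2 - 1 / 4) / (x ^ 2 + y ^ 2)

lemma log_le_aux {t : ℝ} (ht : 1 ≤ t) : Real.log t ≤ (t - t⁻¹) / 2 := by
  rw [← Real.sinh_log (by linarith)]
  exact Real.self_le_sinh_iff.2 (Real.log_nonneg ht)

lemma Uaux_step {x y : ℝ} (hx : 0 < x) :
    Uaux (x + 1) y - Uaux x y ≤ x / (x ^ 2 + y ^ 2) := by
  unfold Uaux
  have hA : 0 < x ^ 2 + y ^ 2 := by positivity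
  have hB : 0 < (x + 1) ^ 2 + y ^ 2 := by positivity
  have h := log_le_aux (t := ((x + 1) ^ 2 + y ^ 2) / (x ^ 2 + y ^ 2))
    (by rw [le_div_iff₀ hA]; nlinarith)
  rw [Real.log_div hB.ne' hA.ne', inv_div] at h
  have e : (((x + 1) ^ 2 + y ^ 2) / (x ^ 2 + y ^ 2) - (x ^ 2 + y ^ 2) / ((x + 1) ^ 2 + y ^ 2)) / 2
      = (x + 1 / 2) / (x ^ 2 + y ^ 2) + (x + 1 / 2) / ((x + 1) ^ 2 + y ^ 2) := by
    field_simp; ring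
  have e2 : x / (x ^ 2 + y ^ 2) + ((x + 1) / 2 - 1 / 4) / ((x + 1) ^ 2 + y ^ 2)
      - (x / 2 - 1 / 4) / (x ^ 2 + y ^ 2) =
      ((x + 1 / 2) / (x ^ 2 + y ^ 2) + (x + 1 / 2) / ((x + 1) ^ 2 + y ^ 2)) / 2 := by
    field_simp; ring
  linarith

lemma Uaux_sum {x y : ℝ} (hx : 0 < x) (n : ℕ) :
    Uaux (x + n) y - Uaux x y ≤
      ∑ k ∈ Finset.range n, (x + k) / ((x + k) ^ 2 + y ^ 2) := by
  induction n with
  | zero => simp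
  | succ n ih =>
    rw [Finset.sum_range_succ]
    have := Uaux_step (x := x + n) (y := y) (by positivity)
    push_cast
    rw [← add_assoc]
    linarith

lemma Uaux_lower {x y : ℝ} (hx : 0 < x) : Real.log x - 1 / (2 * x) ≤ Uaux x y := by
  unfold Uaux
  have hA : 0 < x ^ 2 + y ^ 2 := by positivity
  have h1 : 2 * Real.log x ≤ Real.log (x ^ 2 + y ^ 2) := by
    have : 2 * Real.log x = Real.log (x ^ 2) := by rw [Real.log_pow]; norm_num
    rw [this]
    exact Real.log_le_log (by positivity) (by nlinarith)
  have h2 : (x / 2 - 1 / 4) / (x ^ 2 + y ^ 2) ≤ 1 / (2 * x) := by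
    rw [div_le_div_iff₀ hA (by positivity)]
    nlinarith [sq_nonneg y]
  linarith

noncomputable def Laux (n : ℕ) (y x : ℝ) : ℝ :=
  x * Real.log n + Real.log (n.factorial) -
    ∑ k ∈ Finset.range (n + 1), Real.log ((x + k) ^ 2 + y ^ 2) / 2

lemma Laux_hasDerivAt (n : ℕ) (y : ℝ) {x : ℝ} (hx : 0 < x) :
    HasDerivAt (Laux n y)
      (Real.log n - ∑ k ∈ Finset.range (n + 1), (x + k) / ((x + k) ^ 2 + y ^ 2)) x := by
  unfold Laux
  refine HasDerivAt.sub ?_ (HasDerivAt.fun_sum fun k _ => ?_)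
  · simpa using ((hasDerivAt_id x).mul_const (Real.log n)).add_const (Real.log (n.factorial))
  · have hA : 0 < (x + k) ^ 2 + y ^ 2 := by positivity
    have h := (((((hasDerivAt_id x).add_const (k : ℝ)).pow 2).add_const (y ^ 2)).log hA.ne').div_const 2
    refine h.congr_deriv ?_
    simp
    field_simp

lemma Laux_deriv_le (n : ℕ) (hn : 1 ≤ n) (y : ℝ) {x : ℝ} (hx : 0 < x) :
    deriv (Laux n y) x ≤ Uaux x y + 1 / (2 * (n + 1)) := by
  rw [(Laux_hasDerivAt n y hx).deriv]
  have h1 := Uaux_sum (y := y) hx (n + 1)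
  have hX : 0 < x + ((n + 1 : ℕ) : ℝ) := by positivity
  have h2 := Uaux_lower (y := y) hX
  have hn' : (1 : ℝ) ≤ n := by exact_mod_cast hn
  have h3 : Real.log n ≤ Real.log (x + ((n + 1 : ℕ) : ℝ)) :=
    Real.log_le_log (by linarith) (by push_cast; linarith)
  have h4 : 1 / (2 * (x + ((n + 1 : ℕ) : ℝ))) ≤ 1 / (2 * ((n : ℝ) + 1)) := by
    apply one_div_le_one_div_of_le (by positivity)
    push_cast; linarith
  linarith

lemma log_norm_GammaSeq (n : ℕ) (hn : 1 ≤ n) (x y : ℝ) (hx : 0 < x) :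
    Real.log ‖Complex.GammaSeq ⟨x, y⟩ n‖ = Laux n y x := by
  unfold Complex.GammaSeq Laux
  have hk : ∀ k : ℕ, ‖(⟨x, y⟩ + k : ℂ)‖ = √((x + k) ^ 2 + y ^ 2) := by
    intro k
    rw [Complex.norm_eq_sqrt_sq_add_sq]
    simp
  have hp : ∀ k : ℕ, 0 < (x + k) ^ 2 + y ^ 2 := fun k => by positivity
  have hn0 : (0 : ℝ) < n := by exact_mod_cast hn
  have hprod : ∀ k ∈ Finset.range (n + 1), √((x + k) ^ 2 + y ^ 2) ≠ 0 :=
    fun k _ => (Real.sqrt_pos.2 (hp k)).ne'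
  rw [norm_div, norm_mul, norm_prod, Complex.norm_natCast_cpow_of_pos hn, Complex.norm_natCast]
  simp_rw [hk]
  rw [Real.log_div (mul_ne_zero (by positivity) (by positivity)) (Finset.prod_ne_zero_iff.2 hprod),
    Real.log_mul (by positivity) (by positivity), Real.log_rpow hn0, Real.log_prod hprod]
  congr 1
  exact Finset.sum_congr rfl fun k _ => Real.log_sqrt (hp k).le

lemma Laux_tendsto (x y : ℝ) (hx : 0 < x) :
    Filter.Tendsto (fun n => Laux n y x) Filter.atTop
      (nhds (Real.log ‖Complex.Gamma ⟨x, y⟩‖)) := by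
  have h := Complex.GammaSeq_tendsto_Gamma ⟨x, y⟩
  have hne : Complex.Gamma ⟨x, y⟩ ≠ 0 := Complex.Gamma_ne_zero_of_re_pos hx
  refine (h.norm.log (norm_ne_zero_iff.2 hne)).congr' ?_
  filter_upwards [Filter.eventually_ge_atTop 1] with n hn
  exact log_norm_GammaSeq n hn x y hx

lemma Uaux_continuousAt (y : ℝ) {x : ℝ} (hx : 0 < x) :
    ContinuousAt (fun u => Uaux u y) x := by
  unfold Uaux
  have hA : x ^ 2 + y ^ 2 ≠ 0 := by positivity
  fun_prop (disch := exact hA)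

lemma logGamma_hasDerivAt (x y : ℝ) (hx : 0 < x) :
    HasDerivAt (fun u : ℝ => Real.log ‖Complex.Gamma ⟨u, y⟩‖) (Complex.digamma ⟨x, y⟩).re x := by
  have hne : Complex.Gamma ⟨x, y⟩ ≠ 0 := Complex.Gamma_ne_zero_of_re_pos hx
  have hd : DifferentiableAt ℂ Complex.Gamma ⟨x, y⟩ := by
    apply Complex.differentiableAt_Gamma
    intro m h
    have := congrArg Complex.re h
    simp at this
    have : (0 : ℝ) ≤ m := by positivity
    linarith
  have h1 : HasDerivAt (fun u : ℝ => (⟨u, y⟩ : ℂ)) 1 x := by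
    have : (fun u : ℝ => (⟨u, y⟩ : ℂ)) = fun u : ℝ => (u : ℂ) + y * Complex.I := by
      funext u; exact Complex.mk_eq_add_mul_I u y
    rw [this]
    exact (Complex.ofRealCLM.hasDerivAt (x := x)).add_const _
  have h2 : HasDerivAt (fun u : ℝ => Complex.Gamma ⟨u, y⟩) (deriv Complex.Gamma ⟨x, y⟩) x := by
    have := HasDerivAt.comp (𝕜 := ℝ) (𝕜' := ℂ) x (h₂ := Complex.Gamma) hd.hasDerivAt h1
    simpa [Function.comp_def] using this
  have h3 := (h2.norm_sq.log (by positivity)).div_const 2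
  have e : (fun u : ℝ => Real.log ‖Complex.Gamma ⟨u, y⟩‖) =
      fun u : ℝ => Real.log (‖Complex.Gamma ⟨u, y⟩‖ ^ 2) / 2 := by
    funext u; rw [Real.log_pow]; push_cast; ring
  rw [e]
  refine h3.congr_deriv ?_
  rw [Complex.digamma_def, logDeriv_apply, Complex.div_re, ← Complex.normSq_eq_norm_sq,
    Complex.inner]
  have : Complex.normSq (Complex.Gamma ⟨x, y⟩) ≠ 0 := by simpa using hne
  simp
  field_simp

lemma digamma_le_U (x y : ℝ) (hx : 0 < x) : (Complex.digamma ⟨x, y⟩).re ≤ Uaux x y := by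
  refine le_of_forall_pos_le_add fun ε hε => ?_
  have hc := Uaux_continuousAt y hx
  obtain ⟨δ, hδ, hδU⟩ := Metric.continuousAt_iff.1 hc ε hε
  have hslope := (logGamma_hasDerivAt x y hx).tendsto_slope_zero_right
  refine le_of_tendsto hslope ?_
  filter_upwards [Ioo_mem_nhdsGT hδ] with h hh
  obtain ⟨h0, h1⟩ := hh
  have key : ∀ n : ℕ, 1 ≤ n → Laux n y (x + h) - Laux n y x ≤
      (Uaux x y + ε + 1 / (2 * (n + 1))) * (x + h - x) := by
    intro n hn
    have hpos : ∀ u ∈ Set.Icc x (x + h), 0 < u := fun u hu => by linarith [hu.1]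
    refine Convex.image_sub_le_mul_sub_of_deriv_le (convex_Icc x (x + h))
      (fun u hu => (Laux_hasDerivAt n y (hpos u hu)).continuousAt.continuousWithinAt)
      (fun u hu => (Laux_hasDerivAt n y
        (hpos u (interior_subset hu))).differentiableAt.differentiableWithinAt)
      ?_ x ⟨le_rfl, by linarith⟩ (x + h) ⟨by linarith, le_rfl⟩ (by linarith)
    intro u hu
    have hu' := interior_subset hu
    have a := Laux_deriv_le n hn y (hpos u hu')
    have b := hδU (x := u) (by rw [Real.dist_eq, abs_of_nonneg (by linarith [hu'.1])]; linarith [hu'.2])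
    rw [Real.dist_eq] at b
    have := (abs_lt.1 b).2
    linarith
  have t1 : Filter.Tendsto (fun n => Laux n y (x + h) - Laux n y x) Filter.atTop _ :=
    (Laux_tendsto (x + h) y (by linarith)).sub (Laux_tendsto x y hx)
  have t0 : Filter.Tendsto (fun n : ℕ => (1 : ℝ) / (2 * (n + 1))) Filter.atTop (nhds 0) := by
    have := (tendsto_one_div_add_atTop_nhds_zero_nat (𝕜 := ℝ)).const_mul (1 / 2)
    rw [mul_zero] at this
    refine this.congr fun n => ?_
    field_simp
  have t2 := (t0.const_add (Uaux x y + ε)).mul_const (x + h - x)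
  have := le_of_tendsto_of_tendsto t1 t2
    (Filter.eventually_atTop.2 ⟨1, fun n hn => key n hn⟩)
  rw [smul_eq_mul, inv_mul_le_iff₀ h0]
  linarith

lemma euler_bound : Real.eulerMascheroniConstant + 0.084 ≤ Real.log 2 := by
  have h := Real.eulerMascheroniConstant_lt_eulerMascheroniSeq' 16
  have l16 : Real.log 16 = 4 * Real.log 2 := by
    rw [show (16 : ℝ) = 2 ^ 4 by norm_num, Real.log_pow]; norm_num
  have e : Real.eulerMascheroniSeq' 16 = 2436559 / 720720 - Real.log 16 := by
    simp [Real.eulerMascheroniSeq', harmonic, Finset.sum_range_succ]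
    norm_num
  have := Real.log_two_gt_d9
  rw [e, l16] at h
  norm_num at *
  linarith

lemma log_tangent {t a : ℝ} (ha : 0 < a) (ht : 0 < t) : Real.log t ≤ Real.log a + t / a - 1 := by
  have := Real.log_le_sub_one_of_pos (div_pos ht ha)
  rw [Real.log_div ht.ne' ha.ne'] at this
  linarith

lemma log_one_var {t : ℝ} (ht : 1 ≤ t) :
    Real.log t ≤ 0.168 + (t - 1) / 3 + (1 - 1 / t) / 2 := by
  have ht0 : 0 < t := by linarith
  have l2 := Real.log_two_lt_d9
  rcases le_total t (3 / 2) with h | h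
  · have h1 := Real.log_le_sub_one_of_pos ht0
    have : 1 / t ≤ 0.336 + 1 - 4 * (t - 1) / 3 := by
      rw [div_le_iff₀ ht0]; nlinarith
    linarith
  rcases le_total t (5 / 2) with h' | h'
  · have h1 := log_tangent (a := 2) (by norm_num) ht0
    have : 1 / t ≤ 0.336 + 2 * (t - 1) / 3 + 1 - 2 * (0.694 + t / 2 - 1) := by
      rw [div_le_iff₀ ht0]; nlinarith
    linarith
  · have h1 := log_tangent (a := 3) (by norm_num) ht0
    have l3 : Real.log 3 ≤ 1.104 := by
      have h27 := log_tangent (t := 27) (a := 32) (by norm_num) (by norm_num)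
      rw [show (27 : ℝ) = 3 ^ 3 by norm_num, show (32 : ℝ) = 2 ^ 5 by norm_num, Real.log_pow,
        Real.log_pow] at h27
      norm_num at h27 l2 ⊢
      linarith
    have : 1 / t ≤ 0.4 := by
      rw [div_le_iff₀ ht0]; linarith
    linarith

lemma log_two_var {x A : ℝ} (hx : 1 / 4 ≤ x) (hA : 0 < A) :
    Real.log (A + (2 * x + 1)) / 2 - (x / 2 + 1 / 4) / (A + (2 * x + 1)) - x / A ≤
      Real.log A / 2 + 0.084 := by
  have hA' : 0 < A + 3 / 2 := by linarith
  have hB : 0 < A + (2 * x + 1) := by linarith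
  have h1 := log_tangent hA' hB
  have h2 := log_one_var (t := (A + 3 / 2) / A) (by rw [le_div_iff₀ hA]; linarith)
  rw [Real.log_div hA'.ne' hA.ne', one_div_div] at h2
  have e1 : ((A + 3 / 2) / A - 1) / 3 = (1 / 2) / A := by field_simp; ring
  have e2 : 1 - A / (A + 3 / 2) = (3 / 2) / (A + 3 / 2) := by field_simp; ring
  have e3 : (A + (2 * x + 1)) / (A + 3 / 2) = 1 + 2 * ((x - 1 / 4) / (A + 3 / 2)) := by
    field_simp; ring
  have e4 : (x - 1 / 4) / (A + 3 / 2) ≤ (x - 1 / 4) / A :=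
    div_le_div_of_nonneg_left (by linarith) hA (by linarith)
  have e5 : (3 / 2) / (A + 3 / 2) ≤ 4 * ((x / 2 + 1 / 4) / (A + (2 * x + 1))) := by
    rw [← mul_div_assoc, div_le_div_iff₀ hA' hB]
    nlinarith
  have e6 : x / A = (x - 1 / 4) / A + ((1 / 2) / A) / 2 := by field_simp; ring
  rw [e1, e2] at h2
  rw [e3] at h1
  rw [e6]
  linarith

lemma digamma_bound (x y : ℝ) (hx : 1 / 4 ≤ x) :
    (Complex.digamma ⟨x, y⟩).re ≤
      -Real.eulerMascheroniConstant + Real.log 2 + Real.log (x ^ 2 + y ^ 2) / 2 := by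
  have hx0 : 0 < x := by linarith
  have h1 := digamma_le_U (x + 1) y (by linarith)
  have h2 := Complex.digamma_apply_add_one ⟨x, y⟩ (by
    intro m h
    have := congrArg Complex.re h
    simp at this
    have : (0 : ℝ) ≤ m := by positivity
    linarith)
  have e : (⟨x, y⟩ + 1 : ℂ) = ⟨x + 1, y⟩ := by apply Complex.ext <;> simp
  rw [e] at h2
  have h3 := congrArg Complex.re h2
  have h4 := log_two_var hx (A := x ^ 2 + y ^ 2) (by positivity)
  have h5 := euler_bound
  have e2 : x ^ 2 + y ^ 2 + (2 * x + 1) = (x + 1) ^ 2 + y ^ 2 := by ring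
  rw [e2] at h4
  unfold Uaux at h1
  have e3 : (x + 1) / 2 - 1 / 4 = x / 2 + 1 / 4 := by ring
  rw [e3] at h1
  simp [Complex.inv_re, Complex.normSq_apply, ← sq] at h3
  linarith

theorem stmt_6 (s : ℂ) (hs : 1 / 2 ≤ s.re) :
    (deriv (fun z : ℂ => (π : ℂ) ^ (-z / 2) * Complex.Gamma (z / 2)) s /
        ((π : ℂ) ^ (-s / 2) * Complex.Gamma (s / 2))).re ≤
      -(Real.log π + Real.eulerMascheroniConstant) / 2 +
        (1 / 4) * Real.log (s.re ^ 2 + s.im ^ 2) := by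
  have hre : (s / 2).re = s.re / 2 := by simp
  have him : (s / 2).im = s.im / 2 := by simp
  have hpos : 0 < (s / 2).re := by rw [hre]; linarith
  have hG : Complex.Gamma (s / 2) ≠ 0 := Complex.Gamma_ne_zero_of_re_pos hpos
  have hpi : (π : ℂ) ≠ 0 := by exact_mod_cast Real.pi_ne_zero
  have hP : (π : ℂ) ^ (-s / 2) ≠ 0 := by simp [Complex.cpow_eq_zero_iff, hpi]
  have hd : DifferentiableAt ℂ Complex.Gamma (s / 2) := by
    apply Complex.differentiableAt_Gamma
    intro m h
    have := congrArg Complex.re h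
    rw [hre] at this
    simp at this
    have : (0 : ℝ) ≤ m := by positivity
    linarith
  have d1 : HasDerivAt (fun z : ℂ => (π : ℂ) ^ (-z / 2))
      ((π : ℂ) ^ (-s / 2) * Complex.log π * (-1 / 2)) s :=
    (((hasDerivAt_id s).neg).div_const 2).const_cpow (Or.inl hpi)
  have d2 : HasDerivAt (fun z : ℂ => Complex.Gamma (z / 2))
      (deriv Complex.Gamma (s / 2) * (1 / 2)) s :=
    hd.hasDerivAt.comp s ((hasDerivAt_id s).div_const 2)
  rw [(d1.fun_mul d2).deriv]
  have e : ((π : ℂ) ^ (-s / 2) * Complex.log π * (-1 / 2) * Complex.Gamma (s / 2) +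
      (π : ℂ) ^ (-s / 2) * (deriv Complex.Gamma (s / 2) * (1 / 2))) /
      ((π : ℂ) ^ (-s / 2) * Complex.Gamma (s / 2)) =
      ((-1 / 2 : ℝ) : ℂ) * ((Real.log π : ℝ) : ℂ) + ((1 / 2 : ℝ) : ℂ) * Complex.digamma (s / 2) := by
    rw [Complex.digamma_def, logDeriv_apply, Complex.ofReal_log Real.pi_pos.le]
    push_cast
    field_simp
  rw [e, Complex.add_re, Complex.re_ofReal_mul, Complex.re_ofReal_mul, Complex.ofReal_re]
  have hb := digamma_bound (s / 2).re (s / 2).im (by rw [hre]; linarith)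
  rw [Complex.eta, hre, him] at hb
  have hS : 0 < s.re ^ 2 + s.im ^ 2 := by
    have : 0 < s.re := by linarith
    positivity
  have l : Real.log ((s.re / 2) ^ 2 + (s.im / 2) ^ 2) =
      Real.log (s.re ^ 2 + s.im ^ 2) - 2 * Real.log 2 := by
    rw [show (s.re / 2) ^ 2 + (s.im / 2) ^ 2 = (s.re ^ 2 + s.im ^ 2) / 2 ^ 2 by ring,
      Real.log_div hS.ne' (by norm_num), Real.log_pow]
    norm_num
  rw [l] at hb
  linarith
end

section
/- Let a₀, b₀ be real numbers with b₀ > a₀ > 0, let d > 0 be real, set ε := (2/d)·√a₀·(√b₀ − √a₀), and let δ be a real number with 0 ≤ δ < (2/d)·(√b₀ − √a₀)². Then 2a₀/ε − 2b₀/(ε+δ) < −d. -/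
/-- key elementary inequality for the zero-free region: for
`b₀ > a₀ > 0`, `d > 0`, `ε = (2/d)·√a₀·(√b₀ − √a₀)`, and
`0 ≤ δ < (2/d)·(√b₀ − √a₀)²`, one has `2a₀/ε − 2b₀/(ε+δ) < −d`. -/
theorem stmt_7 (a₀ b₀ d δ : ℝ) (ha : 0 < a₀) (hab : a₀ < b₀) (hd : 0 < d)
    (hδ0 : 0 ≤ δ) (hδ : δ < 2 / d * (Real.sqrt b₀ - Real.sqrt a₀) ^ 2) :
    2 * a₀ / (2 / d * Real.sqrt a₀ * (Real.sqrt b₀ - Real.sqrt a₀)) -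
        2 * b₀ / (2 / d * Real.sqrt a₀ * (Real.sqrt b₀ - Real.sqrt a₀) + δ) < -d := by
  have hx : 0 < Real.sqrt a₀ := Real.sqrt_pos.mpr ha
  have hxy : Real.sqrt a₀ < Real.sqrt b₀ := Real.sqrt_lt_sqrt ha.le hab
  have hxa : a₀ = Real.sqrt a₀ ^ 2 := (Real.sq_sqrt ha.le).symm
  have hyb : b₀ = Real.sqrt b₀ ^ 2 := (Real.sq_sqrt (ha.trans hab).le).symm
  generalize Real.sqrt a₀ = x at *
  generalize Real.sqrt b₀ = y at *
  subst hxa hyb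
  have hy : 0 < y := hx.trans hxy
  have ht : 0 < y - x := sub_pos.mpr hxy
  have he : 0 < 2 / d * x * (y - x) := by positivity
  have h1 : 2 * x ^ 2 / (2 / d * x * (y - x)) = d * x / (y - x) := by
    field_simp
  have h2 : 2 * y ^ 2 / (2 / d * y * (y - x)) = d * y / (y - x) := by
    field_simp
  have hlt : 2 / d * x * (y - x) + δ < 2 / d * y * (y - x) := by
    have : 2 / d * y * (y - x) = 2 / d * x * (y - x) + 2 / d * (y - x) ^ 2 := by ring
    linarith
  have h3 : 2 * y ^ 2 / (2 / d * y * (y - x)) < 2 * y ^ 2 / (2 / d * x * (y - x) + δ) :=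
    div_lt_div_of_pos_left (by positivity) (by linarith) hlt
  have h4 : d * x / (y - x) - d * y / (y - x) = -d := by
    field_simp
    ring
  rw [h1]
  rw [h2] at h3
  linarith
end

section
/- Let a₀, b₀ be real numbers with b₀ > a₀ > 0, let a₁, b₁ ≥ 0 be real numbers with a₁·b₀ ≤ b₁·a₀, let d > 0 be real, set ε := (2/d)·√a₀·(√b₀ − √a₀), let δ be a real number with 0 ≤ δ < (2/d)·(√b₀ − √a₀)², and let t be any real number. Then 4a₁/(ε² + 4t²) − 4b₁/((ε+δ)² + 4t²) ≤ 0. -/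
/-- key elementary inequality for the zero-free region, shifted
points: for `b₀ > a₀ > 0`, `a₁, b₁ ≥ 0` with `a₁·b₀ ≤ b₁·a₀`, `d > 0`,
`ε = (2/d)·√a₀·(√b₀ − √a₀)`, `0 ≤ δ < (2/d)·(√b₀ − √a₀)²`, and any real `t`,
one has `4a₁/(ε² + 4t²) − 4b₁/((ε+δ)² + 4t²) ≤ 0`. -/
theorem stmt_8 (a₀ b₀ a₁ b₁ d δ t : ℝ) (ha : 0 < a₀) (hab : a₀ < b₀)
    (ha1 : 0 ≤ a₁) (hb1 : 0 ≤ b₁) (hmult : a₁ * b₀ ≤ b₁ * a₀) (hd : 0 < d)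
    (hδ0 : 0 ≤ δ) (hδ : δ < 2 / d * (Real.sqrt b₀ - Real.sqrt a₀) ^ 2) :
    4 * a₁ / ((2 / d * Real.sqrt a₀ * (Real.sqrt b₀ - Real.sqrt a₀)) ^ 2 + 4 * t ^ 2) -
        4 * b₁ / ((2 / d * Real.sqrt a₀ * (Real.sqrt b₀ - Real.sqrt a₀) + δ) ^ 2 + 4 * t ^ 2)
      ≤ 0 := by
  have hp : 0 < Real.sqrt a₀ := Real.sqrt_pos.mpr ha
  have hpq : Real.sqrt a₀ < Real.sqrt b₀ := Real.sqrt_lt_sqrt ha.le hab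
  have hp2 : Real.sqrt a₀ ^ 2 = a₀ := Real.sq_sqrt ha.le
  have hq2 : Real.sqrt b₀ ^ 2 = b₀ := Real.sq_sqrt (ha.trans hab).le
  have hk : 0 < 2 / d := by positivity
  generalize Real.sqrt a₀ = p at *
  generalize Real.sqrt b₀ = q at *
  generalize 2 / d = k at *
  have hε : 0 < k * p * (q - p) := mul_pos (mul_pos hk hp) (sub_pos.mpr hpq)
  have h1 : (k * p * (q - p) + δ) * p ≤ k * p * (q - p) * q := by
    nlinarith [mul_le_mul_of_nonneg_right hδ.le hp.le]
  generalize k * p * (q - p) = e at *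
  have h2 : ((e + δ) * p) ^ 2 ≤ (e * q) ^ 2 := pow_le_pow_left₀ (by positivity) h1 2
  have hX : 0 < e ^ 2 + 4 * t ^ 2 := by positivity
  have hY : 0 < (e + δ) ^ 2 + 4 * t ^ 2 := by positivity
  have h3 : ((e + δ) ^ 2 + 4 * t ^ 2) * a₀ ≤ (e ^ 2 + 4 * t ^ 2) * b₀ := by
    rw [mul_pow, mul_pow, hp2, hq2] at h2
    nlinarith [mul_le_mul_of_nonneg_left hab.le (sq_nonneg t)]
  generalize e ^ 2 + 4 * t ^ 2 = X at *
  generalize (e + δ) ^ 2 + 4 * t ^ 2 = Y at *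
  have h4 : a₁ * Y ≤ b₁ * X := by
    refine le_of_mul_le_mul_right ?_ ha
    nlinarith [mul_le_mul_of_nonneg_left h3 ha1, mul_le_mul_of_nonneg_right hmult hX.le]
  rw [sub_nonpos, div_le_div_iff₀ hX hY]
  linarith
end

section
/- Let m ≥ 1 be an integer, k ≥ 2 an even integer, Q ≥ 1 a real number with (k−1)Q ≥ 11, and T ≥ 200 a real number. Define G₁ := (m+1)/π, G₂ := (1/π)[(m+1)·log(√2·(k−1)Q(m+2)/(2πe)) + log(m+2)], G₃ := (1/π)·15.998·(m+1), G₄ := (1/π)·15.998·(m+1)·log(17555·(k−1)Q(m+2)), and G₅ := (1/π)·(31.996 + (m+3)/6). Let S be a finite multiset of real numbers whose counting function N(t) := #{γ ∈ S : |γ| ≤ t} satisfies N(t) ≤ G₁·t·log t + G₂·t + G₃·log t + G₄ + G₅/t for all t ∈ [1, T]. Then Σ_{γ ∈ S, 1 < |γ| < T} 1/|γ| ≤ 1.114·(m+1)·log²((k−1)Q(m+2)T). -/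
open Real

open scoped Classical

/-- Single-point partial summation. -/
lemma aux_single (x T : ℝ) (hx : 1 < x) (hxT : x < T) :
    IntervalIntegrable (fun t : ℝ => if x ≤ t then 1 / t ^ 2 else 0) MeasureTheory.volume 1 T ∧
    ∫ t in (1:ℝ)..T, (if x ≤ t then 1 / t ^ 2 else 0) = 1 / x - 1 / T := by
  have h1 : IntervalIntegrable (fun t : ℝ => if x ≤ t then 1 / t ^ 2 else 0)
      MeasureTheory.volume 1 x := by
    refine IntervalIntegrable.congr_uIoo (f := fun _ => (0:ℝ)) (by simp) ?_
    intro t ht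
    rw [Set.uIoo_of_le hx.le] at ht
    simp [not_le.mpr ht.2]
  have hc : ContinuousOn (fun t : ℝ => 1 / t ^ 2) (Set.uIcc x T) := by
    rw [Set.uIcc_of_le hxT.le]
    refine ContinuousOn.div continuousOn_const (by fun_prop) ?_
    intro t ht
    have : 0 < t := by linarith [ht.1]
    positivity
  have h2 : IntervalIntegrable (fun t : ℝ => if x ≤ t then 1 / t ^ 2 else 0)
      MeasureTheory.volume x T := by
    refine IntervalIntegrable.congr_uIoo (f := fun t : ℝ => 1 / t ^ 2)
      hc.intervalIntegrable ?_
    intro t ht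
    rw [Set.uIoo_of_le hxT.le] at ht
    simp [ht.1.le]
  refine ⟨h1.trans h2, ?_⟩
  rw [← intervalIntegral.integral_add_adjacent_intervals h1 h2]
  have e1 : ∫ t in (1:ℝ)..x, (if x ≤ t then 1 / t ^ 2 else 0) = 0 := by
    rw [intervalIntegral.integral_congr_uIoo (g := fun _ => (0:ℝ))]
    · simp
    · intro t ht
      rw [Set.uIoo_of_le hx.le] at ht
      simp [not_le.mpr ht.2]
  have e2 : ∫ t in x..T, (if x ≤ t then 1 / t ^ 2 else 0) = ∫ t in x..T, 1 / t ^ 2 := by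
    apply intervalIntegral.integral_congr
    intro t ht
    rw [Set.uIcc_of_le hxT.le] at ht
    simp [ht.1]
  have e3 : ∫ t in x..T, 1 / t ^ 2 = (-(1 / T)) - (-(1 / x)) := by
    refine intervalIntegral.integral_eq_sub_of_hasDerivAt (f := fun t : ℝ => -(1 / t)) ?_
      hc.intervalIntegrable
    intro t ht
    rw [Set.uIcc_of_le hxT.le] at ht
    have : t ≠ 0 := by linarith [ht.1]
    have h := (hasDerivAt_inv this).neg
    refine (h.congr_deriv ?_).congr_of_eventuallyEq ?_
    · simp
    · exact Filter.Eventually.of_forall (fun y => by simp)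
  rw [e1, e2, e3]
  ring

lemma aux_multi (T : ℝ) (S : Multiset ℝ) : (∀ x ∈ S, 1 < |x| ∧ |x| < T) →
    IntervalIntegrable (fun t : ℝ => ((S.filter (fun γ => |γ| ≤ t)).card : ℝ) * (1 / t ^ 2))
      MeasureTheory.volume 1 T ∧
    (S.map (fun γ => 1 / |γ|)).sum = (S.card : ℝ) / T +
      ∫ t in (1:ℝ)..T, ((S.filter (fun γ => |γ| ≤ t)).card : ℝ) * (1 / t ^ 2) := by
  induction S using Multiset.induction_on with
  | empty => intro _; simp
  | cons a S ih =>
    intro h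
    obtain ⟨i1, i2⟩ := ih (fun x hx => h x (Multiset.mem_cons_of_mem hx))
    obtain ⟨ha1, ha2⟩ := h a (Multiset.mem_cons_self a S)
    obtain ⟨j1, j2⟩ := aux_single |a| T ha1 ha2
    have e : (fun t : ℝ => (((a ::ₘ S).filter (fun γ => |γ| ≤ t)).card : ℝ) * (1 / t ^ 2)) =
        fun t : ℝ => (if |a| ≤ t then 1 / t ^ 2 else 0) +
          ((S.filter (fun γ => |γ| ≤ t)).card : ℝ) * (1 / t ^ 2) := by
      funext t
      by_cases hat : |a| ≤ t
      · rw [Multiset.filter_cons_of_pos (p := fun γ => |γ| ≤ t) S hat]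
        simp only [Multiset.card_cons, hat, if_true]
        push_cast
        ring
      · rw [Multiset.filter_cons_of_neg (p := fun γ => |γ| ≤ t) S hat]
        simp [hat]
    rw [e]
    refine ⟨j1.add i1, ?_⟩
    rw [intervalIntegral.integral_add j1 i1, j2, Multiset.map_cons, Multiset.sum_cons, i2,
      Multiset.card_cons]
    push_cast
    ring

lemma aux_partial (T : ℝ) (hT : 1 < T) (S : Multiset ℝ) (A B C D E : ℝ)
    (hN : ∀ t ∈ Set.Icc (1 : ℝ) T, ((S.filter (fun γ => |γ| ≤ t)).card : ℝ) ≤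
      A * t * Real.log t + B * t + C * Real.log t + D + E / t) :
    ((S.filter (fun γ => 1 < |γ| ∧ |γ| < T)).map (fun γ => 1 / |γ|)).sum ≤
      A * (Real.log T ^ 2 / 2 + Real.log T) + B * (Real.log T + 1) + C * (1 - 1 / T) + D
        + E / 2 * (1 + 1 / T ^ 2) := by
  set R := S.filter (fun γ => 1 < |γ| ∧ |γ| < T) with hR
  have hR1 : ∀ x ∈ R, 1 < |x| ∧ |x| < T := fun x hx => (Multiset.mem_filter.mp hx).2
  have hRS : R ≤ S := Multiset.filter_le _ _
  obtain ⟨i1, i2⟩ := aux_multi T R hR1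
  have hpos : 0 < T := by linarith
  rw [i2]
  have hcard : (R.card : ℝ) ≤ A * T * Real.log T + B * T + C * Real.log T + D + E / T := by
    refine le_trans ?_ (hN T ⟨hT.le, le_rfl⟩)
    have : R = R.filter (fun γ => |γ| ≤ T) :=
      (Multiset.filter_eq_self.mpr (fun x hx => (hR1 x hx).2.le)).symm
    rw [this]
    exact_mod_cast Multiset.card_le_card (Multiset.filter_le_filter _ hRS)
  have hc : ContinuousOn (fun t : ℝ => (A * t * Real.log t + B * t + C * Real.log t + D + E / t)
      * (1 / t ^ 2)) (Set.uIcc 1 T) := by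
    rw [Set.uIcc_of_le hT.le]
    intro t ht
    have h0 : t ≠ 0 := by linarith [ht.1]
    have h2 : t ^ 2 ≠ 0 := pow_ne_zero _ h0
    apply ContinuousAt.continuousWithinAt
    fun_prop (disch := assumption)
  have hint : ∫ t in (1:ℝ)..T, ((R.filter (fun γ => |γ| ≤ t)).card : ℝ) * (1 / t ^ 2) ≤
      ∫ t in (1:ℝ)..T, (A * t * Real.log t + B * t + C * Real.log t + D + E / t)
        * (1 / t ^ 2) := by
    refine intervalIntegral.integral_mono_on hT.le i1 hc.intervalIntegrable ?_
    intro t ht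
    have h0 : 0 < t := by linarith [ht.1]
    refine mul_le_mul_of_nonneg_right ?_ (by positivity)
    refine le_trans ?_ (hN t ht)
    exact_mod_cast Multiset.card_le_card (Multiset.filter_le_filter _ hRS)
  have hF : ∫ t in (1:ℝ)..T, (A * t * Real.log t + B * t + C * Real.log t + D + E / t)
        * (1 / t ^ 2) =
      (A * (Real.log T ^ 2 / 2) + B * Real.log T - C * ((1 + Real.log T) * T⁻¹) - D * T⁻¹
        - E / 2 * (T⁻¹) ^ 2) -
      (A * (Real.log 1 ^ 2 / 2) + B * Real.log 1 - C * ((1 + Real.log 1) * 1⁻¹) - D * 1⁻¹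
        - E / 2 * (1⁻¹) ^ 2) := by
    refine intervalIntegral.integral_eq_sub_of_hasDerivAt
      (f := fun t : ℝ => A * (Real.log t ^ 2 / 2) + B * Real.log t
        - C * ((1 + Real.log t) * t⁻¹) - D * t⁻¹ - E / 2 * (t⁻¹) ^ 2) ?_ hc.intervalIntegrable
    intro t ht
    rw [Set.uIcc_of_le hT.le] at ht
    have h0 : t ≠ 0 := by linarith [ht.1]
    have hl := Real.hasDerivAt_log h0
    have hi := hasDerivAt_inv h0
    have h := (((((hl.pow 2).div_const 2).const_mul A).add (hl.const_mul B)).sub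
      (((hl.const_add 1).mul hi).const_mul C)).sub (hi.const_mul D) |>.sub
      ((hi.pow 2).const_mul (E / 2))
    refine h.congr_deriv ?_
    have e : (2 - 1 : ℕ) = 1 := rfl
    rw [e]
    push_cast
    simp only [pow_one]
    field_simp
    ring
  rw [hF] at hint
  have hd : (R.card : ℝ) / T ≤
      (A * T * Real.log T + B * T + C * Real.log T + D + E / T) / T := by gcongr
  refine (add_le_add hd hint).trans (le_of_eq ?_)
  rw [Real.log_one]
  field_simp
  ring

lemma aux_poly (a L : ℝ) (ha : 3.49 ≤ a) (hL : 5.29 ≤ L) :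
    (L ^ 2 / 2 + L) + (a - 1.893) * (L + 1) + 15.998 + 15.998 * (9.776 + a) + 8.18
      ≤ 3.1415 * (1.114 * (a + L) ^ 2) := by
  obtain ⟨x, rfl⟩ : ∃ x, a = 3.49 + x := ⟨a - 3.49, by ring⟩
  obtain ⟨y, rfl⟩ : ∃ y, L = 5.29 + y := ⟨L - 5.29, by ring⟩
  have hx : 0 ≤ x := by linarith
  have hy : 0 ≤ y := by linarith
  nlinarith [mul_nonneg hx hy, mul_nonneg hx hx, mul_nonneg hy hy]

lemma aux_logs : 3.49 ≤ Real.log 33 ∧ 5.29 ≤ Real.log 200 ∧ Real.log 17555 ≤ 9.776 ∧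
    Real.log 3 ≤ 1.1 ∧ 1.097 ≤ Real.log 3 := by
  have l1 := Real.log_two_gt_d9
  have l2 := Real.log_two_lt_d9
  have hp : ∀ (x : ℝ) (n : ℕ), Real.log (x ^ n) = n * Real.log x := fun x n => by rw [Real.log_pow]
  refine ⟨?_, ?_, ?_, ?_, ?_⟩
  · have h : Real.log 33 = 5 * Real.log 2 + Real.log (33/32) := by
      have := hp 2 5
      rw [show (33:ℝ) = 2 ^ 5 * (33/32) by norm_num, Real.log_mul (by norm_num) (by norm_num), this]
      norm_num
    have := Real.one_sub_inv_le_log_of_pos (show (0:ℝ) < 33/32 by norm_num)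
    norm_num at this h ⊢
    linarith
  · have h : Real.log 200 = 3 * Real.log 2 + 2 * Real.log 5 := by
      have a := hp 2 3
      have b := hp 5 2
      rw [show (200:ℝ) = 2 ^ 3 * 5 ^ 2 by norm_num, Real.log_mul (by norm_num) (by norm_num), a, b]
      norm_num
    have h2 : 3 * Real.log 5 = 7 * Real.log 2 + Real.log (125/128) := by
      have a := hp 2 7
      have b := hp 5 3
      have : Real.log (5 ^ 3) = Real.log (2 ^ 7) + Real.log (125/128) := by
        rw [← Real.log_mul (by norm_num) (by norm_num)]; norm_num
      rw [a, b] at this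
      exact_mod_cast this
    have := Real.one_sub_inv_le_log_of_pos (show (0:ℝ) < 125/128 by norm_num)
    norm_num at this ⊢
    linarith
  · have h : Real.log 17555 = 14 * Real.log 2 + Real.log (17555/16384) := by
      have a := hp 2 14
      have : Real.log 17555 = Real.log (2 ^ 14) + Real.log (17555/16384) := by
        rw [← Real.log_mul (by norm_num) (by norm_num)]; norm_num
      rw [a] at this
      exact_mod_cast this
    have := Real.log_le_sub_one_of_pos (show (0:ℝ) < 17555/16384 by norm_num)
    norm_num at this ⊢
    linarith
  all_goals
    have h : 12 * Real.log 3 = 19 * Real.log 2 + Real.log (531441/524288) := by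
      have a := hp 2 19
      have b := hp 3 12
      have : Real.log (3 ^ 12) = Real.log (2 ^ 19) + Real.log (531441/524288) := by
        rw [← Real.log_mul (by norm_num) (by norm_num)]; norm_num
      rw [a, b] at this
      exact_mod_cast this
    have u := Real.log_le_sub_one_of_pos (show (0:ℝ) < 531441/524288 by norm_num)
    have v := Real.log_nonneg (show (1:ℝ) ≤ 531441/524288 by norm_num)
    norm_num at u v ⊢
    linarith

set_option maxHeartbeats 2000000 in
/-- Lemma 6.2 of the paper, sum of `1/|γ|` over zeros of
intermediate height, by partial summation from the Riemann–von Mangoldt-type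
bound. -/
theorem stmt_13 (m k : ℕ) (hm : 1 ≤ m) (hk : 2 ≤ k) (hke : Even k)
    (Q T : ℝ) (hQ : 1 ≤ Q) (hkQ : 11 ≤ ((k : ℝ) - 1) * Q) (hT : 200 ≤ T)
    (S : Multiset ℝ)
    (hN : ∀ t ∈ Set.Icc (1 : ℝ) T,
      ((S.filter (fun γ => |γ| ≤ t)).card : ℝ) ≤
        (((m : ℝ) + 1) / π) * t * Real.log t +
          ((1 / π) * (((m : ℝ) + 1) *
              Real.log (Real.sqrt 2 * ((k : ℝ) - 1) * Q * ((m : ℝ) + 2) /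
                (2 * π * Real.exp 1)) +
            Real.log ((m : ℝ) + 2))) * t +
          ((1 / π) * 15.998 * ((m : ℝ) + 1)) * Real.log t +
          (1 / π) * 15.998 * ((m : ℝ) + 1) *
            Real.log (17555 * ((k : ℝ) - 1) * Q * ((m : ℝ) + 2)) +
          ((1 / π) * (31.996 + ((m : ℝ) + 3) / 6)) / t) :
    ((S.filter (fun γ => 1 < |γ| ∧ |γ| < T)).map (fun γ => 1 / |γ|)).sum ≤
      1.114 * ((m : ℝ) + 1) * Real.log (((k : ℝ) - 1) * Q * ((m : ℝ) + 2) * T) ^ 2 := by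
  obtain ⟨b33, b200, bK, b3u, b3l⟩ := aux_logs
  have key := aux_partial T (by linarith) S _ _ _ _ _ hN
  refine key.trans ?_
  have hm1 : (1:ℝ) ≤ m := by exact_mod_cast hm
  generalize (m:ℝ) = μ at *
  have hX : ((k:ℝ) - 1) * Q = ((k:ℝ) - 1) * Q := rfl
  rw [show √2 * ((k:ℝ) - 1) * Q * (μ + 2) / (2 * π * Real.exp 1)
      = √2 * (((k:ℝ) - 1) * Q * (μ + 2)) / (2 * π * Real.exp 1) by ring,
    show 17555 * ((k:ℝ) - 1) * Q * (μ + 2) = 17555 * (((k:ℝ) - 1) * Q * (μ + 2)) by ring]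
  have hA : 33 ≤ ((k:ℝ) - 1) * Q * (μ + 2) := by nlinarith
  generalize ((k:ℝ) - 1) * Q * (μ + 2) = A at *
  have hA0 : A ≠ 0 := by linarith
  have hT0 : T ≠ 0 := by linarith
  have hpi := Real.pi_pos
  have e1 : Real.log (√2 * A / (2 * π * Real.exp 1))
      = Real.log A - Real.log 2 / 2 - Real.log π - 1 := by
    rw [Real.log_div (by positivity) (by positivity), Real.log_mul (by positivity) hA0,
      Real.log_mul (by positivity) (by positivity), Real.log_mul (by positivity) (by positivity),
      Real.log_exp, Real.log_sqrt (by norm_num)]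
    ring
  rw [e1, Real.log_mul (by norm_num) hA0, Real.log_mul hA0 hT0]
  have ha : 3.49 ≤ Real.log A := b33.trans (Real.log_le_log (by norm_num) hA)
  have hL : 5.29 ≤ Real.log T := b200.trans (Real.log_le_log (by norm_num) hT)
  have hlpi : 1.097 ≤ Real.log π := b3l.trans (Real.log_le_log (by norm_num) Real.pi_gt_three.le)
  have l2 := Real.log_two_gt_d9
  have hm2 : Real.log (μ + 2) ≤ (μ + 1) * 0.55 := by
    have h : Real.log (μ + 2) = Real.log 3 + Real.log ((μ + 2) / 3) := by
      rw [← Real.log_mul (by norm_num) (by positivity)]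
      congr 1
      ring
    have := Real.log_le_sub_one_of_pos (show (0:ℝ) < (μ + 2) / 3 by positivity)
    linarith
  have hTi : 1 / T ^ 2 ≤ 0.001 := by
    rw [div_le_iff₀ (by positivity)]
    nlinarith
  have hTi1 : 0 ≤ 1 / T := by positivity
  have hTi0 : 0 ≤ 1 / T ^ 2 := by positivity
  have hpil : 3.1415 ≤ π := Real.pi_gt_d4.le
  generalize Real.log A = a at *
  generalize Real.log T = L at *
  generalize 1 / T ^ 2 = r at *
  generalize 1 / T = s at *
  generalize Real.log π = lp at *
  generalize Real.log 2 = l at *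
  generalize Real.log 17555 = K at *
  generalize Real.log (μ + 2) = w at *
  have hμ : 0 < μ + 1 := by linarith
  -- bounds for the five pieces, with the factor `1 / π` removed
  have p2 : ((μ + 1) * (a - l / 2 - lp - 1) + w) * (L + 1)
      ≤ (μ + 1) * ((a - 1.893) * (L + 1)) := by
    have : (μ + 1) * (a - l / 2 - lp - 1) + w ≤ (μ + 1) * (a - 1.893) := by nlinarith
    calc _ ≤ ((μ + 1) * (a - 1.893)) * (L + 1) :=
          mul_le_mul_of_nonneg_right this (by linarith)
      _ = _ := by ring
  have p3 : 15.998 * (μ + 1) * (1 - s) ≤ (μ + 1) * 15.998 := by nlinarith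
  have p4 : 15.998 * (μ + 1) * (K + a) ≤ (μ + 1) * (15.998 * (9.776 + a)) := by nlinarith
  have p5 : (31.996 + (μ + 3) / 6) / 2 * (1 + r) ≤ (μ + 1) * 8.18 := by
    have : (31.996 + (μ + 3) / 6) / 2 ≤ (μ + 1) * 8.17 := by linarith
    nlinarith
  have q : (L ^ 2 / 2 + L) + (a - 1.893) * (L + 1) + 15.998 + 15.998 * (9.776 + a) + 8.18
      ≤ 3.1415 * (1.114 * (a + L) ^ 2) := aux_poly a L ha hL
  have q2 : (μ + 1) * ((L ^ 2 / 2 + L) + (a - 1.893) * (L + 1) + 15.998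
      + 15.998 * (9.776 + a) + 8.18) ≤ π * (1.114 * (μ + 1) * (a + L) ^ 2) := by
    calc _ ≤ (μ + 1) * (3.1415 * (1.114 * (a + L) ^ 2)) := mul_le_mul_of_nonneg_left q hμ.le
      _ = 3.1415 * (1.114 * (μ + 1) * (a + L) ^ 2) := by ring
      _ ≤ _ := mul_le_mul_of_nonneg_right hpil (by positivity)
  calc _ = ((μ + 1) * (L ^ 2 / 2 + L) + ((μ + 1) * (a - l / 2 - lp - 1) + w) * (L + 1)
        + 15.998 * (μ + 1) * (1 - s) + 15.998 * (μ + 1) * (K + a)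
        + (31.996 + (μ + 3) / 6) / 2 * (1 + r)) / π := by ring
    _ ≤ _ := by
      rw [div_le_iff₀ hpi]
      linarith
end

section
/- Let m ≥ 1 be an integer, k ≥ 2 an even integer, Q ≥ 1 a real number with (k−1)Q ≥ 11, and T ≥ 200 a real number. Define G₁ := (m+1)/π, G₂ := (1/π)[(m+1)·log(√2·(k−1)Q(m+2)/(2πe)) + log(m+2)], G₃ := (1/π)·15.998·(m+1), G₄ := (1/π)·15.998·(m+1)·log(17555·(k−1)Q(m+2)), and G₅ := (1/π)·(31.996 + (m+3)/6). Let S be a countable multiset of real numbers whose counting function N(t) := #{γ ∈ S : |γ| ≤ t} is finite for every t and satisfies N(t) ≤ G₁·t·log t + G₂·t + G₃·log t + G₄ + G₅/t for all t ≥ T. Then the sum Σ_{γ ∈ S, |γ| > T} 1/γ² converges and is at most 0.753·(m+1)·log((k−1)Q(m+2)T)/T. -/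
open Real

open MeasureTheory Set Filter Topology

lemma aux_tend (a : ℝ) : Tendsto (fun t : ℝ => a / t) atTop (𝓝 0) :=
  tendsto_const_nhds.div_atTop tendsto_id

lemma aux_log : Tendsto (fun t : ℝ => Real.log t / t) atTop (𝓝 0) :=
  Real.isLittleO_log_id_atTop.tendsto_div_nhds_zero

lemma aux_kernel (g : ℝ) (hg : 0 < g) :
    IntegrableOn (fun t : ℝ => 2 / t ^ 3) (Ioi g) ∧ ∫ t in Ioi g, 2 / t ^ 3 = 1 / g ^ 2 := by
  have hd : ∀ t ∈ Ici g, HasDerivAt (fun t : ℝ => -(1 / t ^ 2)) (2 / t ^ 3) t := by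
    intro t ht
    have ht0 : t ≠ 0 := (lt_of_lt_of_le hg ht).ne'
    have h := ((hasDerivAt_const t (1 : ℝ)).div (hasDerivAt_pow 2 t) (pow_ne_zero 2 ht0)).neg
    refine HasDerivAt.congr_deriv h ?_
    field_simp
    norm_num
    ring
  have hn : ∀ t ∈ Ioi g, (0 : ℝ) ≤ 2 / t ^ 3 := by
    intro t ht
    have : 0 < t := lt_trans hg ht
    positivity
  have hl : Tendsto (fun t : ℝ => -(1 / t ^ 2)) atTop (𝓝 0) := by
    have h := ((aux_tend 1).mul (aux_tend 1)).neg
    simp only [mul_zero, neg_zero] at h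
    refine h.congr fun t => ?_
    rw [div_mul_div_comm]; ring
  refine ⟨integrableOn_Ioi_deriv_of_nonneg' hd hn hl, ?_⟩
  rw [integral_Ioi_of_hasDerivAt_of_nonneg' hd hn hl]
  ring

lemma aux_bound (a b c d e T : ℝ) (hT : 0 < T)
    (hB : ∀ t, T ≤ t → 0 ≤ a * t * Real.log t + b * t + c * Real.log t + d + e / t) :
    IntegrableOn (fun t : ℝ => 2 / t ^ 3 *
      (a * t * Real.log t + b * t + c * Real.log t + d + e / t)) (Ioi T) ∧
    ∫ t in Ioi T, 2 / t ^ 3 * (a * t * Real.log t + b * t + c * Real.log t + d + e / t) =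
      2 * a * (Real.log T + 1) / T + 2 * b / T + c * (Real.log T + 1 / 2) / T ^ 2 + d / T ^ 2
        + 2 / 3 * e / T ^ 3 := by
  set F : ℝ → ℝ := fun t => -(2 * a * (Real.log t + 1) / t + 2 * b / t
    + c * (Real.log t + 1 / 2) / t ^ 2 + d / t ^ 2 + 2 / 3 * e / t ^ 3) with hF
  have hd : ∀ t ∈ Ici T, HasDerivAt F (2 / t ^ 3 *
      (a * t * Real.log t + b * t + c * Real.log t + d + e / t)) t := by
    intro t ht
    have ht0 : t ≠ 0 := (lt_of_lt_of_le hT ht).ne'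
    have hlog := Real.hasDerivAt_log ht0
    have h1 := (((hlog.add_const 1).const_mul (2 * a)).div (hasDerivAt_id t) ht0)
    have h2 := (hasDerivAt_const t (2 * b)).div (hasDerivAt_id t) ht0
    have h3 := (((hlog.add_const (1 / 2)).const_mul c).div (hasDerivAt_pow 2 t)
      (pow_ne_zero 2 ht0))
    have h4 := (hasDerivAt_const t d).div (hasDerivAt_pow 2 t) (pow_ne_zero 2 ht0)
    have h5 := (hasDerivAt_const t (2 / 3 * e)).div (hasDerivAt_pow 3 t) (pow_ne_zero 3 ht0)
    have h := ((((h1.add h2).add h3).add h4).add h5).neg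
    refine HasDerivAt.congr_deriv h ?_
    simp only [id]
    field_simp
    push_cast
    ring
  have hn : ∀ t ∈ Ioi T, (0 : ℝ) ≤ 2 / t ^ 3 *
      (a * t * Real.log t + b * t + c * Real.log t + d + e / t) := by
    intro t ht
    have : 0 < t := lt_trans hT ht
    exact mul_nonneg (by positivity) (hB t (le_of_lt ht))
  have hl : Tendsto F atTop (𝓝 0) := by
    have t1 := aux_tend 1
    have h1 := (aux_log.add t1).const_mul (2 * a)
    have h2 := aux_tend (2 * b)
    have h3 := ((aux_log.add (aux_tend (1 / 2))).mul t1).const_mul c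
    have h4 := (aux_tend d).mul t1
    have h5 := ((aux_tend (2 / 3 * e)).mul t1).mul t1
    have h := ((((h1.add h2).add h3).add h4).add h5).neg
    simp only [mul_zero, add_zero, neg_zero] at h
    refine h.congr fun t => ?_
    simp only [hF]
    rcases eq_or_ne t 0 with rfl | ht
    · simp
    · field_simp
  refine ⟨integrableOn_Ioi_deriv_of_nonneg' hd hn hl, ?_⟩
  rw [integral_Ioi_of_hasDerivAt_of_nonneg' hd hn hl]
  simp only [hF]; ring

lemma aux_sum {ι : Type*} (γ : ι → ℝ) (T C : ℝ) (hT : 0 < T) (B : ℝ → ℝ)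
    (hfin : ∀ t : ℝ, {i : ι | |γ i| ≤ t}.Finite)
    (hN : ∀ t : ℝ, T ≤ t → (Nat.card {i : ι | |γ i| ≤ t} : ℝ) ≤ B t)
    (hI : IntegrableOn (fun t : ℝ => 2 / t ^ 3 * B t) (Ioi T))
    (hC : ∫ t in Ioi T, 2 / t ^ 3 * B t ≤ C) (s : Finset ι) :
    (∑ i ∈ s, if T < |γ i| then 1 / (γ i) ^ 2 else 0) ≤ C := by
  classical
  rw [← Finset.sum_filter]
  set u := s.filter (fun i => T < |γ i|) with hu
  have hk : ∀ i ∈ u, IntegrableOn ((Ici |γ i|).indicator (fun t : ℝ => 2 / t ^ 3)) (Ioi T) ∧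
      ∫ t in Ioi T, (Ici |γ i|).indicator (fun t : ℝ => 2 / t ^ 3) t = 1 / (γ i) ^ 2 := by
    intro i hi
    have hTi : T < |γ i| := (Finset.mem_filter.1 hi).2
    obtain ⟨-, h2⟩ := aux_kernel |γ i| (hT.trans hTi)
    refine ⟨((aux_kernel T hT).1).indicator measurableSet_Ici, ?_⟩
    rw [setIntegral_indicator measurableSet_Ici,
      inter_eq_right.2 (Ici_subset_Ioi.2 hTi), integral_Ici_eq_integral_Ioi, h2,
      sq_abs]
  rw [← Finset.sum_congr rfl (fun i hi => (hk i hi).2),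
    ← integral_finsetSum u (fun i hi => (hk i hi).1)]
  refine le_trans (setIntegral_mono_on (integrable_finsetSum u (fun i hi => (hk i hi).1)) hI
    measurableSet_Ioi ?_) hC
  intro t ht
  have ht0 : 0 < t := lt_trans hT ht
  have hcard : ((u.filter (fun i => |γ i| ≤ t)).card : ℝ) ≤ B t := by
    refine le_trans ?_ (hN t (le_of_lt ht))
    rw [Nat.card_coe_set_eq, ← Set.ncard_coe_finset]
    have hsub : ((u.filter (fun i => |γ i| ≤ t) : Finset ι) : Set ι) ⊆ {i : ι | |γ i| ≤ t} := by
      intro i hi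
      exact (Finset.mem_filter.1 (Finset.mem_coe.1 hi)).2
    exact Nat.cast_le.2 (Set.ncard_le_ncard hsub (hfin t))
  calc ∑ i ∈ u, (Ici |γ i|).indicator (fun t : ℝ => 2 / t ^ 3) t
      = ∑ i ∈ u, if |γ i| ≤ t then 2 / t ^ 3 else 0 := by
        simp only [indicator_apply, mem_Ici]
    _ = 2 / t ^ 3 * ((u.filter (fun i => |γ i| ≤ t)).card : ℝ) := by
        rw [← Finset.sum_filter, Finset.sum_const, nsmul_eq_mul, mul_comm]
    _ ≤ _ := by gcongr

lemma aux_num (M A T : ℝ) (hM : 2 ≤ M) (hA : 33 ≤ A) (hT : 200 ≤ T) :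
    2 * (M / π) * (Real.log T + 1) / T +
      2 * ((1 / π) * (M * Real.log (Real.sqrt 2 * A / (2 * π * Real.exp 1)) +
        Real.log (M + 1))) / T +
      ((1 / π) * 15.998 * M) * (Real.log T + 1 / 2) / T ^ 2 +
      (1 / π) * 15.998 * M * Real.log (17555 * A) / T ^ 2 +
      2 / 3 * ((1 / π) * (31.996 + (M + 2) / 6)) / T ^ 3 ≤
    0.753 * M * Real.log (A * T) / T := by
  have hT0 : 0 < T := by linarith
  have hA0 : 0 < A := by linarith
  have hpi := Real.pi_gt_d6
  have hpi0 := Real.pi_pos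
  have he := Real.exp_one_gt_d9
  have he' := Real.exp_one_lt_d9
  have hs : Real.sqrt 2 ≤ 1.5 := by
    rw [Real.sqrt_le_left (by norm_num)]; norm_num
  have hs0 : 0 < Real.sqrt 2 := by positivity
  have hAT : Real.log (A * T) = Real.log A + Real.log T :=
    Real.log_mul hA0.ne' hT0.ne'
  have hATge : 4 ≤ Real.log A + Real.log T := by
    rw [← hAT, Real.le_log_iff_exp_le (by positivity)]
    have h : Real.exp 4 = Real.exp 1 ^ 4 := by rw [← Real.exp_nat_mul]; norm_num
    rw [h]
    calc Real.exp 1 ^ 4 ≤ 3 ^ 4 := by gcongr; linarith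
      _ ≤ 33 * 200 := by norm_num
      _ ≤ A * T := by gcongr
  have h1 : Real.log (Real.sqrt 2 * A / (2 * π * Real.exp 1)) ≤ Real.log A - 2 := by
    have h2 : Real.log A - 2 = Real.log (A / Real.exp 1 ^ 2) := by
      rw [Real.log_div hA0.ne' (by positivity), Real.log_pow, Real.log_exp]; norm_num
    rw [h2]
    apply Real.log_le_log (by positivity)
    rw [div_le_div_iff₀ (by positivity) (by positivity)]
    have : Real.sqrt 2 * Real.exp 1 ≤ 2 * π := by
      calc Real.sqrt 2 * Real.exp 1 ≤ 1.5 * 2.8 := by gcongr; linarith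
        _ ≤ 2 * π := by linarith
    calc Real.sqrt 2 * A * Real.exp 1 ^ 2 = A * Real.exp 1 * (Real.sqrt 2 * Real.exp 1) := by ring
      _ ≤ A * Real.exp 1 * (2 * π) := by gcongr
      _ = _ := by ring
  have h3 : Real.log (M + 1) ≤ M := by
    have := Real.log_le_sub_one_of_pos (show 0 < M + 1 by linarith)
    linarith
  have h4 : Real.log (17555 * A) ≤ 10 + Real.log A := by
    rw [Real.log_mul (by norm_num) hA0.ne']
    have : Real.log 17555 ≤ 10 := by
      rw [Real.log_le_iff_le_exp (by norm_num)]
      have h : Real.exp 10 = Real.exp 1 ^ 10 := by rw [← Real.exp_nat_mul]; norm_num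
      rw [h]
      calc (17555 : ℝ) ≤ 2.7 ^ 10 := by norm_num
        _ ≤ _ := by gcongr; linarith
    linarith
  set lA := Real.log A
  set lT := Real.log T
  set x := lA + lT with hx
  rw [hAT]
  have e1 : 15.998 * M * (x + 10.5) / T ≤ 0.08 * M * (x + 10.5) := by
    rw [div_le_iff₀ hT0]
    have : 0 ≤ M * (x + 10.5) := by apply mul_nonneg <;> linarith
    nlinarith
  have e2 : 2 / 3 * (31.996 + (M + 2) / 6) / T ^ 2 ≤ 0.01 * M := by
    rw [div_le_iff₀ (by positivity)]
    have : (200 : ℝ) ^ 2 ≤ T ^ 2 := by gcongr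
    nlinarith
  have e3 : 2 * M * (lT + 1) + 2 * (M * Real.log (Real.sqrt 2 * A / (2 * π * Real.exp 1)) +
      Real.log (M + 1)) + 15.998 * M * (lT + 1 / 2) / T +
      15.998 * M * Real.log (17555 * A) / T + 2 / 3 * (31.996 + (M + 2) / 6) / T ^ 2
      ≤ 0.753 * π * M * x := by
    have f1 : M * Real.log (Real.sqrt 2 * A / (2 * π * Real.exp 1)) ≤ M * (lA - 2) := by gcongr
    have f2 : 15.998 * M * Real.log (17555 * A) / T ≤ 15.998 * M * (10 + lA) / T := by gcongr
    have f3 : 15.998 * M * (lT + 1 / 2) / T + 15.998 * M * (10 + lA) / T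
      = 15.998 * M * (x + 10.5) / T := by rw [hx]; ring
    have f4 : 2.365 * (M * x) ≤ 0.753 * π * (M * x) := by
      have : 0 ≤ M * x := by apply mul_nonneg <;> linarith
      gcongr; linarith
    have f5 : M * 4 ≤ M * x := by gcongr
    have f6 : M * x = M * lA + M * lT := by rw [hx]; ring
    nlinarith
  have e4 := mul_le_mul_of_nonneg_left e3 (show 0 ≤ 1 / (π * T) by positivity)
  refine le_trans (le_of_eq ?_) (e4.trans (le_of_eq ?_))
  · field_simp
  · field_simp

/-- Lemma 6.3 of the paper, sum of `1/γ²` over high zeros, by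
partial summation from the Riemann–von Mangoldt-type bound. The countable
multiset of real numbers is represented by a function `γ` on a countable index
type. -/
theorem stmt_14 (m k : ℕ) (hm : 1 ≤ m) (hk : 2 ≤ k) (hke : Even k)
    (Q T : ℝ) (hQ : 1 ≤ Q) (hkQ : 11 ≤ ((k : ℝ) - 1) * Q) (hT : 200 ≤ T)
    (ι : Type*) [Countable ι] (γ : ι → ℝ)
    (hfin : ∀ t : ℝ, {i : ι | |γ i| ≤ t}.Finite)
    (hN : ∀ t : ℝ, T ≤ t →
      (Nat.card {i : ι | |γ i| ≤ t} : ℝ) ≤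
        (((m : ℝ) + 1) / π) * t * Real.log t +
          ((1 / π) * (((m : ℝ) + 1) *
              Real.log (Real.sqrt 2 * ((k : ℝ) - 1) * Q * ((m : ℝ) + 2) /
                (2 * π * Real.exp 1)) +
            Real.log ((m : ℝ) + 2))) * t +
          ((1 / π) * 15.998 * ((m : ℝ) + 1)) * Real.log t +
          (1 / π) * 15.998 * ((m : ℝ) + 1) *
            Real.log (17555 * ((k : ℝ) - 1) * Q * ((m : ℝ) + 2)) +
          ((1 / π) * (31.996 + ((m : ℝ) + 3) / 6)) / t) :
    Summable (fun i : ι => if T < |γ i| then 1 / (γ i) ^ 2 else 0) ∧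
      (∑' i : ι, if T < |γ i| then 1 / (γ i) ^ 2 else 0) ≤
        0.753 * ((m : ℝ) + 1) *
          Real.log (((k : ℝ) - 1) * Q * ((m : ℝ) + 2) * T) / T := by
  have hM : (2 : ℝ) ≤ (m : ℝ) + 1 := by
    have : (1 : ℝ) ≤ m := by exact_mod_cast hm
    linarith
  have hT0 : 0 < T := by linarith
  have hA : 33 ≤ ((k : ℝ) - 1) * Q * ((m : ℝ) + 2) := by nlinarith
  have hB := aux_bound _ _ _ _ _ T hT0 (fun t ht => le_trans (Nat.cast_nonneg _) (hN t ht))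
  have hnum := aux_num ((m : ℝ) + 1) _ T hM hA hT
  have key := aux_sum γ T _ hT0 _ hfin hN hB.1 (hB.2.le.trans (le_trans (le_of_eq ?_) hnum))
  · have hnn : ∀ i, 0 ≤ (if T < |γ i| then 1 / (γ i) ^ 2 else 0) := by
      intro i; split_ifs <;> positivity
    exact ⟨summable_of_sum_le hnn key, Real.tsum_le_of_sum_le hnn key⟩
  · have r1 : √2 * ((k : ℝ) - 1) * Q * ((m : ℝ) + 2) = √2 * (((k : ℝ) - 1) * Q * ((m : ℝ) + 2)) := by
      ring
    have r2 : 17555 * ((k : ℝ) - 1) * Q * ((m : ℝ) + 2)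
      = 17555 * (((k : ℝ) - 1) * Q * ((m : ℝ) + 2)) := by ring
    have r3 : (m : ℝ) + 1 + 1 = m + 2 := by ring
    have r4 : (m : ℝ) + 1 + 2 = m + 3 := by ring
    rw [r1, r2, r3, r4]
end
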